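/- arXiv:1611.05442 — 2 statements merged into one kernel-verified Lean document; each statement's English description precedes it below -/
import Mathlib

section
/- Let U = [[A_U, B_U],[C_U, D_U]] and V = [[A_V, B_V],[C_V, D_V]] be complex block matrices with blocks of matching sizes, and let F_U = D_U − C_U A_U⁺ B_U and F_V = D_V − C_V A_V⁺ B_V be the pseudo Schur complements. Suppose R(B_U) ⊆ R(A_U), R((A_U⁺ B_U)ᴴ) ⊆ R(F_Uᴴ), R(C_Vᴴ) ⊆ R(A_Vᴴ) and R(C_V A_V⁺) ⊆ R(F_V). If (U, V) is a Moore-Penrose inverse absorbing pair, then (F_U, F_V) is also a Moore-Penrose inverse absorbing pair. -/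
open Matrix

/-- `X` is the Moore-Penrose inverse of `A`. -/
def IsMoorePenrose {m n : Type*} [Fintype m] [Fintype n]
    (A : Matrix m n ℂ) (X : Matrix n m ℂ) : Prop :=
  A * X * A = A ∧ X * A * X = X ∧ (A * X)ᴴ = A * X ∧ (X * A)ᴴ = X * A

/-- The column space (range) of a complex matrix. -/
noncomputable def colSpace {m n : Type*} [Fintype n] (A : Matrix m n ℂ) :
    Submodule ℂ (m → ℂ) :=
  LinearMap.range A.mulVecLin

section MoorePenrose

variable {m n p s : Type*} [Fintype m] [Fintype n] [Fintype p] [Fintype s]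

theorem IsMoorePenrose.conjTranspose {A : Matrix m n ℂ} {X : Matrix n m ℂ}
    (h : IsMoorePenrose A X) : IsMoorePenrose Aᴴ Xᴴ := by
  obtain ⟨h1, h2, h3, h4⟩ := h
  refine ⟨?_, ?_, ?_, ?_⟩
  · rw [← conjTranspose_mul, ← conjTranspose_mul, ← Matrix.mul_assoc, h1]
  · rw [← conjTranspose_mul, ← conjTranspose_mul, ← Matrix.mul_assoc, h2]
  · rw [← conjTranspose_mul, h4, h4]
  · rw [← conjTranspose_mul, h3, h3]

/-- If `R(B) ⊆ R(A)`, then the projection `A A⁺` fixes `B`. -/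
theorem IsMoorePenrose.mul_mul_eq_of_colSpace_le {A : Matrix m n ℂ} {X : Matrix n m ℂ}
    (h : IsMoorePenrose A X) {B : Matrix m p ℂ} (hB : colSpace B ≤ colSpace A) :
    A * X * B = B := by
  classical
  refine Matrix.ext_of_mulVec_single fun j => ?_
  obtain ⟨v, hv⟩ := hB ⟨Pi.single j 1, rfl⟩
  simp only [mulVecLin_apply] at hv
  rw [← mulVec_mulVec, ← hv, mulVec_mulVec, h.1]

/-- If `R(Bᴴ) ⊆ R(Aᴴ)`, then the projection `A⁺ A` fixes `B` from the right. -/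
theorem IsMoorePenrose.mul_mul_eq_of_colSpace_conjTranspose_le
    {A : Matrix m n ℂ} {X : Matrix n m ℂ} (h : IsMoorePenrose A X) {B : Matrix p n ℂ}
    (hB : colSpace Bᴴ ≤ colSpace Aᴴ) : B * (X * A) = B := by
  have := congrArg Matrix.conjTranspose (h.conjTranspose.mul_mul_eq_of_colSpace_le hB)
  simpa [Matrix.conjTranspose_mul] using this

/-- `V U⁺ U = V` is equivalent to `U⁺ U V⁺ = V⁺`. -/
theorem IsMoorePenrose.mul_mul_eq_left_iff {U V : Matrix m n ℂ} {X Y : Matrix n m ℂ}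
    (hU : IsMoorePenrose U X) (hV : IsMoorePenrose V Y) :
    V * (X * U) = V ↔ X * U * Y = Y := by
  constructor
  · intro h
    have key : X * U * (Y * V) = Y * V := by
      rw [← hU.2.2.2, ← hV.2.2.2, ← conjTranspose_mul, Matrix.mul_assoc Y, h]
    calc X * U * Y = X * U * (Y * V) * Y := by
          rw [Matrix.mul_assoc (X * U), hV.2.1]
      _ = Y := by rw [key, hV.2.1]
  · intro h
    have key : Y * V * (X * U) = Y * V := by
      rw [← hU.2.2.2, ← hV.2.2.2, ← conjTranspose_mul, ← Matrix.mul_assoc (X * U), h]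
    calc V * (X * U) = V * (Y * V * (X * U)) := by
          rw [← Matrix.mul_assoc V (Y * V), ← Matrix.mul_assoc V Y, hV.1]
      _ = V := by rw [key, ← Matrix.mul_assoc, hV.1]

/-- `V V⁺ U = U` is equivalent to `U⁺ V V⁺ = U⁺`. -/
theorem IsMoorePenrose.mul_mul_eq_right_iff {U V : Matrix m n ℂ} {X Y : Matrix n m ℂ}
    (hU : IsMoorePenrose U X) (hV : IsMoorePenrose V Y) :
    V * Y * U = U ↔ X * (V * Y) = X := by
  have := hV.conjTranspose.mul_mul_eq_left_iff hU.conjTranspose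
  rw [← conjTranspose_mul, ← conjTranspose_mul, ← conjTranspose_mul] at this
  simpa only [conjTranspose_inj] using this

/-- `(U, V)` is a Moore-Penrose inverse absorbing pair iff `R(Vᴴ) ⊆ R(Uᴴ)` and `R(U) ⊆ R(V)`,
both inclusions being expressed through orthogonal projections. -/
theorem IsMoorePenrose.absorbing_iff {U V : Matrix m n ℂ} {X Y : Matrix n m ℂ}
    (hU : IsMoorePenrose U X) (hV : IsMoorePenrose V Y) :
    X + Y = X * (U + V) * Y ↔ V * (X * U) = V ∧ V * Y * U = U := by
  rw [hU.mul_mul_eq_left_iff hV, hU.mul_mul_eq_right_iff hV, Matrix.mul_add, Matrix.add_mul,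
    Matrix.mul_assoc X V Y]
  constructor
  · intro h
    have hY : X * U * Y = Y := by
      have h' := congrArg (X * U * ·) h
      simp only [Matrix.mul_add, ← Matrix.mul_assoc, hU.2.1] at h'
      have h'' : X + X * U * Y = X + Y := by
        rw [h', h, ← Matrix.mul_assoc X V Y]
      exact add_left_cancel h''
    rw [hY, add_comm] at h
    exact ⟨hY, (add_left_cancel h).symm⟩
  · rintro ⟨h1, h2⟩
    rw [h1, h2, add_comm]

/-- Inheritance of row space inclusion by pseudo Schur complements. -/
theorem schur_mul_mul_eq_of_fromBlocks_mul_mul_eq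
    {AU AV : Matrix m n ℂ} {BU BV : Matrix m p ℂ} {CU CV : Matrix s n ℂ} {DU DV : Matrix s p ℂ}
    {AUp AVp : Matrix n m ℂ} {FUp : Matrix p s ℂ} {Up : Matrix (n ⊕ p) (m ⊕ s) ℂ}
    (hAU : IsMoorePenrose AU AUp) (hFU : IsMoorePenrose (DU - CU * AUp * BU) FUp)
    (hB : colSpace BU ≤ colSpace AU)
    (hX : colSpace (AUp * BU)ᴴ ≤ colSpace (DU - CU * AUp * BU)ᴴ)
    (hUV : fromBlocks AV BV CV DV * (Up * fromBlocks AU BU CU DU) = fromBlocks AV BV CV DV) :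
    (DV - CV * AVp * BV) * (FUp * (DU - CU * AUp * BU)) = DV - CV * AVp * BV := by
  classical
  have hX' := hFU.mul_mul_eq_of_colSpace_conjTranspose_le hX
  have hB' := hAU.mul_mul_eq_of_colSpace_le hB
  have hF : (DU - CU * AUp * BU) * (FUp * (DU - CU * AUp * BU)) = DU - CU * AUp * BU := by
    rw [← Matrix.mul_assoc, hFU.1]
  obtain ⟨Z, hZ⟩ : ∃ Z : Matrix p p ℂ, Z = 1 - FUp * (DU - CU * AUp * BU) := ⟨_, rfl⟩
  have hXZ : AUp * BU * Z = 0 := by rw [hZ, Matrix.mul_sub, hX', Matrix.mul_one, sub_self]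
  have hFZ : (DU - CU * AUp * BU) * Z = 0 := by
    rw [hZ, Matrix.mul_sub, hF, Matrix.mul_one, sub_self]
  have hBZ : BU * Z = 0 := by
    rw [← hB', Matrix.mul_assoc AU, Matrix.mul_assoc AU, hXZ, Matrix.mul_zero]
  have hDZ : DU * Z = 0 := by
    rwa [Matrix.sub_mul, Matrix.mul_assoc CU, Matrix.mul_assoc CU, hXZ, Matrix.mul_zero,
      sub_zero] at hFZ
  have hVZ : fromBlocks AV BV CV DV * fromRows (0 : Matrix n p ℂ) Z = 0 := by
    rw [← hUV, Matrix.mul_assoc, Matrix.mul_assoc, fromBlocks_mul_fromRows, hBZ, hDZ]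
    simp
  rw [fromBlocks_mul_fromRows, ← fromRows_zero, fromRows_inj.eq_iff] at hVZ
  simp only [Matrix.mul_zero, zero_add] at hVZ
  have hFVZ : (DV - CV * AVp * BV) * Z = 0 := by
    rw [Matrix.sub_mul, Matrix.mul_assoc _ BV, hVZ.1, hVZ.2, Matrix.mul_zero, sub_zero]
  rw [hZ, Matrix.mul_sub, Matrix.mul_one, sub_eq_zero] at hFVZ
  exact hFVZ.symm

end MoorePenrose

theorem inheritance_pseudo_schur_moore_penrose_absorbing {m n p s : ℕ}
    (AU : Matrix (Fin m) (Fin n) ℂ) (BU : Matrix (Fin m) (Fin p) ℂ)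
    (CU : Matrix (Fin s) (Fin n) ℂ) (DU : Matrix (Fin s) (Fin p) ℂ)
    (AV : Matrix (Fin m) (Fin n) ℂ) (BV : Matrix (Fin m) (Fin p) ℂ)
    (CV : Matrix (Fin s) (Fin n) ℂ) (DV : Matrix (Fin s) (Fin p) ℂ)
    (AUp AVp : Matrix (Fin n) (Fin m) ℂ)
    (hAU : IsMoorePenrose AU AUp) (hAV : IsMoorePenrose AV AVp)
    (FUp FVp : Matrix (Fin p) (Fin s) ℂ)
    (hFU : IsMoorePenrose (DU - CU * AUp * BU) FUp)
    (hFV : IsMoorePenrose (DV - CV * AVp * BV) FVp)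
    (Up Vp : Matrix (Fin n ⊕ Fin p) (Fin m ⊕ Fin s) ℂ)
    (hU : IsMoorePenrose (Matrix.fromBlocks AU BU CU DU) Up)
    (hV : IsMoorePenrose (Matrix.fromBlocks AV BV CV DV) Vp)
    (h1 : colSpace BU ≤ colSpace AU)
    (h2 : colSpace (AUp * BU)ᴴ ≤ colSpace (DU - CU * AUp * BU)ᴴ)
    (h3 : colSpace CVᴴ ≤ colSpace AVᴴ)
    (h4 : colSpace (CV * AVp) ≤ colSpace (DV - CV * AVp * BV))
    (habs : Up + Vp =
      Up * (Matrix.fromBlocks AU BU CU DU + Matrix.fromBlocks AV BV CV DV) * Vp) :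
    FUp + FVp = FUp * ((DU - CU * AUp * BU) + (DV - CV * AVp * BV)) * FVp := by
  obtain ⟨hVU, hUV⟩ := (hU.absorbing_iff hV).1 habs
  refine (hFU.absorbing_iff hFV).2
    ⟨schur_mul_mul_eq_of_fromBlocks_mul_mul_eq hAU hFU h1 h2 hVU, ?_⟩
  have hS (A : Matrix (Fin n) (Fin m) ℂ) (B : Matrix (Fin m) (Fin p) ℂ)
      (C : Matrix (Fin s) (Fin n) ℂ) (D : Matrix (Fin s) (Fin p) ℂ) :
      Dᴴ - Bᴴ * Aᴴ * Cᴴ = (D - C * A * B)ᴴ := by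
    simp only [conjTranspose_sub, conjTranspose_mul, Matrix.mul_assoc]
  have hFV' := hFV.conjTranspose
  rw [← hS] at hFV'
  have h4' : colSpace (AVpᴴ * CVᴴ)ᴴ ≤ colSpace (DVᴴ - BVᴴ * AVpᴴ * CVᴴ)ᴴ := by
    rwa [hS, ← conjTranspose_mul, conjTranspose_conjTranspose, conjTranspose_conjTranspose]
  have hUV' : fromBlocks AUᴴ CUᴴ BUᴴ DUᴴ * (Vpᴴ * fromBlocks AVᴴ CVᴴ BVᴴ DVᴴ) =
      fromBlocks AUᴴ CUᴴ BUᴴ DUᴴ := by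
    rw [← fromBlocks_conjTranspose, ← fromBlocks_conjTranspose, ← conjTranspose_mul,
      ← conjTranspose_mul, hUV]
  have h := schur_mul_mul_eq_of_fromBlocks_mul_mul_eq (AVp := AUpᴴ)
    hAV.conjTranspose hFV' h3 h4' hUV'
  rwa [hS, hS, ← conjTranspose_mul, ← conjTranspose_mul, conjTranspose_inj] at h
end

section
/- Let U = [[A_U, B_U],[C_U, D_U]] and V = [[A_V, B_V],[C_V, D_V]] be complex block matrices with square blocks, where D_U and D_V are group invertible with group inverses D_U#, D_V#, and let L_U = A_U − B_U D_U# C_U and L_V = A_V − B_V D_V# C_V. Suppose L_U and L_V are group invertible, R(C_V) ⊆ R(D_V), R((D_V# C_V)ᴴ) ⊆ R(L_Vᴴ), R(B_Uᴴ) ⊆ R(D_Uᴴ) and R(B_U D_U#) ⊆ R(L_U). If (U, V) is a group inverse absorbing pair, then (L_U, L_V) is also a group inverse absorbing pair. -/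
open Matrix

/-- `X` is the group inverse of `A`. -/
def IsGroupInverse {n : Type*} [Fintype n] (A X : Matrix n n ℂ) : Prop :=
  A * X * A = A ∧ X * A * X = X ∧ A * X = X * A

lemma exists_eq_mul_of_colSpace_le {m n p : Type*} [Fintype n] [Fintype p]
    {M : Matrix m n ℂ} {N : Matrix m p ℂ} (h : colSpace M ≤ colSpace N) :
    ∃ Z : Matrix p n ℂ, M = N * Z := by
  classical
  have key : ∀ j, ∃ z : p → ℂ, N *ᵥ z = M.col j := fun j =>
    h ⟨Pi.single j 1, by simp⟩
  choose z hz using key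
  refine ⟨Matrix.of fun i j => z j i, ?_⟩
  ext i j
  exact (congrFun (hz j) i).symm

lemma exists_eq_mul_of_colSpace_conjTranspose_le {m n p : Type*} [Fintype m] [Fintype p]
    {M : Matrix m n ℂ} {N : Matrix p n ℂ} (h : colSpace Mᴴ ≤ colSpace Nᴴ) :
    ∃ Z : Matrix m p ℂ, M = Z * N := by
  obtain ⟨Z, hZ⟩ := exists_eq_mul_of_colSpace_le h
  refine ⟨Zᴴ, ?_⟩
  rw [← conjTranspose_inj, hZ, conjTranspose_mul, conjTranspose_conjTranspose]

/-- A pair is group inverse absorbing exactly when the two spectral projections agree. -/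
lemma IsGroupInverse.absorbing_iff {n : Type*} [Fintype n] {A X B Y : Matrix n n ℂ}
    (hA : IsGroupInverse A X) (hB : IsGroupInverse B Y) :
    X + Y = X * (A + B) * Y ↔ A * X = B * Y := by
  obtain ⟨a1, a2, a3⟩ := hA
  obtain ⟨b1, b2, b3⟩ := hB
  constructor
  · intro h
    have hl : A * X = A * X * (B * Y) := by
      have e := congrArg (A * ·) h
      have e' : A * (X * (A + B) * Y) = A * X * A * Y + A * X * (B * Y) := by noncomm_ring
      beta_reduce at e
      rw [e', a1, mul_add] at e
      rwa [add_comm, add_right_inj] at e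
    have hr : Y * B = X * A * (Y * B) := by
      have e := congrArg (· * B) h
      have e' : X * (A + B) * Y * B = X * A * (Y * B) + X * (B * Y * B) := by noncomm_ring
      beta_reduce at e
      rw [e', b1, add_mul] at e
      rwa [add_comm, add_left_inj] at e
    rw [← a3, ← b3] at hr
    exact hl.trans hr.symm
  · intro h
    have e : X * (A + B) * Y = X * A * Y + X * (B * Y) := by noncomm_ring
    rw [e, ← h, ← a3, h, b3, b2, ← b3, ← h, ← mul_assoc, a2, add_comm]

/-- If `L * Q = 0` for the pseudo Schur complement `L = A - B * G * C`, where `C = D * G * C` and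
the rows of `G * C` are combinations of those of `L`, then `Q`, padded by zero, is annihilated by
the block matrix. -/
lemma fromBlocks_mul_eq_zero_of_schur {m n : Type*} [Fintype m] [Fintype n]
    {A : Matrix m m ℂ} {B : Matrix m n ℂ} {C : Matrix n m ℂ} {D G : Matrix n n ℂ}
    {Q : Matrix m m ℂ} {Z : Matrix n m ℂ} (hC : D * G * C = C)
    (hZ : G * C = Z * (A - B * G * C)) (hQ : (A - B * G * C) * Q = 0) :
    fromBlocks A B C D * fromBlocks Q 0 0 0 = 0 := by
  have hG : G * (C * Q) = 0 := by
    rw [← Matrix.mul_assoc, hZ, Matrix.mul_assoc, hQ, Matrix.mul_zero]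
  have hCQ : C * Q = 0 := by
    rw [← hC, Matrix.mul_assoc, Matrix.mul_assoc, hG, Matrix.mul_zero]
  have hAQ : A * Q = 0 := by
    simpa [Matrix.sub_mul, Matrix.mul_assoc, hG] using hQ
  simp [fromBlocks_multiply, hCQ, hAQ]

/-- The row version of `fromBlocks_mul_eq_zero_of_schur`. -/
lemma mul_fromBlocks_eq_zero_of_schur {m n : Type*} [Fintype m] [Fintype n]
    {A : Matrix m m ℂ} {B : Matrix m n ℂ} {C : Matrix n m ℂ} {D G : Matrix n n ℂ}
    {Q : Matrix m m ℂ} {Z : Matrix m n ℂ} (hB : B * G * D = B)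
    (hZ : B * G = (A - B * G * C) * Z) (hQ : Q * (A - B * G * C) = 0) :
    fromBlocks Q 0 0 0 * fromBlocks A B C D = 0 := by
  have hG : Q * (B * G) = 0 := by
    rw [hZ, ← Matrix.mul_assoc, hQ, Matrix.zero_mul]
  have hQB : Q * B = 0 := by
    rw [← hB, ← Matrix.mul_assoc, hG, Matrix.zero_mul]
  have hQA : Q * A = 0 := by
    rwa [Matrix.mul_sub, ← Matrix.mul_assoc, hG, Matrix.zero_mul, sub_zero] at hQ
  simp [fromBlocks_multiply, hQB, hQA]

lemma schur_mul_eq_zero_of_fromBlocks {m n : Type*} [Fintype m] [Fintype n]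
    {A : Matrix m m ℂ} {B : Matrix m n ℂ} {C : Matrix n m ℂ} {D : Matrix n n ℂ}
    {Q : Matrix m m ℂ} (G : Matrix n n ℂ)
    (h : fromBlocks A B C D * fromBlocks Q 0 0 0 = 0) : (A - B * G * C) * Q = 0 := by
  rw [fromBlocks_multiply, ← fromBlocks_zero, fromBlocks_inj] at h
  simp only [Matrix.mul_zero, add_zero] at h
  rw [Matrix.sub_mul, h.1, Matrix.mul_assoc, h.2.2.1, Matrix.mul_zero, sub_zero]

lemma mul_schur_eq_zero_of_fromBlocks {m n : Type*} [Fintype m] [Fintype n]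
    {A : Matrix m m ℂ} {B : Matrix m n ℂ} {C : Matrix n m ℂ} {D : Matrix n n ℂ}
    {Q : Matrix m m ℂ} (G : Matrix n n ℂ)
    (h : fromBlocks Q 0 0 0 * fromBlocks A B C D = 0) : Q * (A - B * G * C) = 0 := by
  rw [fromBlocks_multiply, ← fromBlocks_zero, fromBlocks_inj] at h
  simp only [Matrix.zero_mul, add_zero] at h
  rw [Matrix.mul_sub, h.1, ← Matrix.mul_assoc, ← Matrix.mul_assoc, h.2.1, Matrix.zero_mul,
    Matrix.zero_mul, sub_zero]

theorem inheritance_comp_group_schur_group_absorbing {a d : ℕ}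
    (AU : Matrix (Fin a) (Fin a) ℂ) (BU : Matrix (Fin a) (Fin d) ℂ)
    (CU : Matrix (Fin d) (Fin a) ℂ) (DU : Matrix (Fin d) (Fin d) ℂ)
    (AV : Matrix (Fin a) (Fin a) ℂ) (BV : Matrix (Fin a) (Fin d) ℂ)
    (CV : Matrix (Fin d) (Fin a) ℂ) (DV : Matrix (Fin d) (Fin d) ℂ)
    (DUg DVg : Matrix (Fin d) (Fin d) ℂ)
    (hDU : IsGroupInverse DU DUg) (hDV : IsGroupInverse DV DVg)
    (LUg LVg : Matrix (Fin a) (Fin a) ℂ)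
    (hLU : IsGroupInverse (AU - BU * DUg * CU) LUg)
    (hLV : IsGroupInverse (AV - BV * DVg * CV) LVg)
    (Ug Vg : Matrix (Fin a ⊕ Fin d) (Fin a ⊕ Fin d) ℂ)
    (hU : IsGroupInverse (Matrix.fromBlocks AU BU CU DU) Ug)
    (hV : IsGroupInverse (Matrix.fromBlocks AV BV CV DV) Vg)
    (h1 : colSpace CV ≤ colSpace DV)
    (h2 : colSpace (DVg * CV)ᴴ ≤ colSpace (AV - BV * DVg * CV)ᴴ)
    (h3 : colSpace BUᴴ ≤ colSpace DUᴴ)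
    (h4 : colSpace (BU * DUg) ≤ colSpace (AU - BU * DUg * CU))
    (habs : Ug + Vg =
      Ug * (Matrix.fromBlocks AU BU CU DU + Matrix.fromBlocks AV BV CV DV) * Vg) :
    LUg + LVg = LUg * ((AU - BU * DUg * CU) + (AV - BV * DVg * CV)) * LVg := by
  rw [hU.absorbing_iff hV] at habs
  rw [hLU.absorbing_iff hLV]
  obtain ⟨W, hW⟩ := exists_eq_mul_of_colSpace_le h1
  obtain ⟨Z, hZ⟩ := exists_eq_mul_of_colSpace_conjTranspose_le h2
  obtain ⟨W', hW'⟩ := exists_eq_mul_of_colSpace_conjTranspose_le h3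
  obtain ⟨Z', hZ'⟩ := exists_eq_mul_of_colSpace_le h4
  have hC : DV * DVg * CV = CV := by rw [hW, ← Matrix.mul_assoc, hDV.1]
  have hB : BU * DUg * DU = BU := by
    rw [hW', Matrix.mul_assoc, Matrix.mul_assoc, ← Matrix.mul_assoc DU, hDU.1]
  have hker : (AU - BU * DUg * CU) * (1 - (AV - BV * DVg * CV) * LVg) = 0 := by
    have hQ : (AV - BV * DVg * CV) * (1 - (AV - BV * DVg * CV) * LVg) = 0 := by
      rw [hLV.2.2, mul_sub, mul_one, ← mul_assoc, hLV.1, sub_self]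
    apply schur_mul_eq_zero_of_fromBlocks (D := DU)
    rw [← hU.1, mul_assoc (fromBlocks AU BU CU DU), ← hU.2.2, habs, hV.2.2, mul_assoc, mul_assoc,
      fromBlocks_mul_eq_zero_of_schur hC hZ hQ, mul_zero, mul_zero]
  have hran : (1 - (AU - BU * DUg * CU) * LUg) * (AV - BV * DVg * CV) = 0 := by
    have hQ : (1 - (AU - BU * DUg * CU) * LUg) * (AU - BU * DUg * CU) = 0 := by
      rw [sub_mul, one_mul, hLU.1, sub_self]
    apply mul_schur_eq_zero_of_fromBlocks (D := DV)
    rw [← hV.1, ← habs, ← mul_assoc, ← mul_assoc, mul_fromBlocks_eq_zero_of_schur hB hZ' hQ,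
      zero_mul, zero_mul]
  generalize AU - BU * DUg * CU = L at *
  generalize AV - BV * DVg * CV = M at *
  have hl : L = L * (M * LVg) := by rwa [mul_sub, mul_one, sub_eq_zero] at hker
  have hm : M = L * LUg * M := by rwa [sub_mul, one_mul, sub_eq_zero] at hran
  calc L * LUg = LUg * L := hLU.2.2
    _ = LUg * L * (M * LVg) := by rw [mul_assoc, ← hl]
    _ = L * LUg * M * LVg := by rw [← hLU.2.2, mul_assoc _ M]
    _ = M * LVg := by rw [← hm]
end
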